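/- arXiv:2205.00396 — 3 statements merged into one kernel-verified Lean document; each statement's English description precedes it below -/
import Mathlib

section
/- Let F : ℝ → ℝ be locally Lipschitz and satisfy hypotheses (H)_1 and (H)_2, and let q > 2. Then for every ε > 0 there exists l_ε > 0 such that |ξ| ≤ ε|t| + l_ε|t|^{q−1} for every t ∈ ℝ and every ξ ∈ ∂F(t). -/
open Filter Real

/-- The Clarke generalized directional derivative of `F : ℝ → ℝ` at `t` in direction `s`:
`F⁰(t;s) = limsup_{w → t, τ → 0⁺} (F(w + τs) − F(w))/τ`. -/
noncomputable def clarkeDeriv (F : ℝ → ℝ) (t s : ℝ) : ℝ :=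
  Filter.limsup (fun p : ℝ × ℝ => (F (p.1 + p.2 * s) - F p.1) / p.2)
    ((nhds t) ×ˢ (nhdsWithin 0 (Set.Ioi 0)))

/-- The Clarke subdifferential `∂F(t) = {ξ : ξ·s ≤ F⁰(t;s) for all s}`. -/
def clarkeSubdiff (F : ℝ → ℝ) (t : ℝ) : Set ℝ :=
  {ξ : ℝ | ∀ s : ℝ, ξ * s ≤ clarkeDeriv F t s}

theorem eventually_abs_quotient_le {F : ℝ → ℝ} {t K : ℝ} {U : Set ℝ} (hU : U ∈ nhds t)
    (hK : ∀ x ∈ U, ∀ y ∈ U, |F x - F y| ≤ K * |x - y|) (s : ℝ) :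
    ∀ᶠ p : ℝ × ℝ in (nhds t) ×ˢ (nhdsWithin 0 (Set.Ioi 0)),
      |(F (p.1 + p.2 * s) - F p.1) / p.2| ≤ K * |s| := by
  have hle : (nhds t) ×ˢ (nhdsWithin (0 : ℝ) (Set.Ioi 0)) ≤ nhds (t, (0 : ℝ)) := by
    rw [nhds_prod_eq]
    exact Filter.prod_mono le_rfl nhdsWithin_le_nhds
  have hshift : Tendsto (fun p : ℝ × ℝ => p.1 + p.2 * s)
      ((nhds t) ×ˢ (nhdsWithin 0 (Set.Ioi 0))) (nhds t) := by
    have hc : Continuous fun p : ℝ × ℝ => p.1 + p.2 * s := by fun_prop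
    simpa using (hc.tendsto (t, (0 : ℝ))).mono_left hle
  have hpos : ∀ᶠ p : ℝ × ℝ in (nhds t) ×ˢ (nhdsWithin 0 (Set.Ioi 0)), 0 < p.2 :=
    tendsto_snd.eventually self_mem_nhdsWithin
  filter_upwards [hshift.eventually hU, tendsto_fst.eventually hU, hpos] with p h1 h2 h3
  rw [abs_div, abs_of_pos h3, div_le_iff₀ h3]
  calc |F (p.1 + p.2 * s) - F p.1| ≤ K * |p.1 + p.2 * s - p.1| := hK _ h1 _ h2
    _ = K * |s| * p.2 := by
      rw [add_sub_cancel_left, abs_mul, abs_of_pos h3]; ring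

theorem abs_le_of_mem_clarkeSubdiff {F : ℝ → ℝ} {t K ξ : ℝ} {U : Set ℝ} (hU : U ∈ nhds t)
    (hK : ∀ x ∈ U, ∀ y ∈ U, |F x - F y| ≤ K * |x - y|) (hξ : ξ ∈ clarkeSubdiff F t) :
    |ξ| ≤ K := by
  have hbound : ∀ s, ξ * s ≤ K * |s| := by
    intro s
    have h := eventually_abs_quotient_le hU hK s
    refine (hξ s).trans (limsup_le_of_le ?_ (h.mono fun p hp => (abs_le.1 hp).2))
    exact IsBoundedUnder.isCoboundedUnder_le
      (isBoundedUnder_of_eventually_ge (h.mono fun p hp => (abs_le.1 hp).1))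
  have h1 := hbound 1
  have h2 := hbound (-1)
  simp only [abs_neg, abs_one] at h1 h2
  exact abs_le.2 ⟨by linarith, by linarith⟩

theorem LocallyLipschitz.exists_abs_sub_le {F : ℝ → ℝ} (hF : LocallyLipschitz F) (t : ℝ) :
    ∃ K : ℝ, ∃ U ∈ nhds t, ∀ x ∈ U, ∀ y ∈ U, |F x - F y| ≤ K * |x - y| := by
  obtain ⟨K, U, hU, hK⟩ := hF t
  refine ⟨K, U, hU, fun x hx y hy => ?_⟩
  simpa [Real.dist_eq] using hK.dist_le_mul x hx y hy

theorem le_clarkeDeriv_of_frequently {F : ℝ → ℝ} (hF : LocallyLipschitz F) {t s a : ℝ}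
    (h : ∃ᶠ p : ℝ × ℝ in (nhds t) ×ˢ (nhdsWithin 0 (Set.Ioi 0)),
      a ≤ (F (p.1 + p.2 * s) - F p.1) / p.2) : a ≤ clarkeDeriv F t s := by
  obtain ⟨K, U, hU, hK⟩ := hF.exists_abs_sub_le t
  exact le_limsup_of_frequently_le h (isBoundedUnder_of_eventually_le
    ((eventually_abs_quotient_le hU hK s).mono fun p hp => (abs_le.1 hp).2))

theorem mem_clarkeSubdiff_of_isLocalExtr {F : ℝ → ℝ} (hF : LocallyLipschitz F) {c m : ℝ}
    (h : IsLocalExtr (fun x => F x - m * x) c) : m ∈ clarkeSubdiff F c := by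
  intro s
  apply le_clarkeDeriv_of_frequently hF
  have hzero : Tendsto (fun τ : ℝ => τ) (nhdsWithin 0 (Set.Ioi 0)) (nhdsWithin 0 (Set.Ioi 0)) :=
    tendsto_id
  have hpos : ∀ᶠ τ : ℝ in nhdsWithin 0 (Set.Ioi 0), 0 < τ := self_mem_nhdsWithin
  have hline : ∀ r : ℝ, Tendsto (fun τ : ℝ => c + τ * r) (nhdsWithin 0 (Set.Ioi 0)) (nhds c) := by
    intro r
    have hc : Continuous fun τ : ℝ => c + τ * r := by fun_prop
    simpa using (hc.tendsto 0).mono_left nhdsWithin_le_nhds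
  rcases h with hmin | hmax
  · refine (tendsto_const_nhds.prodMk hzero).frequently (Eventually.frequently ?_)
    filter_upwards [hpos, (hline s).eventually hmin] with τ hτ hle
    rw [le_div_iff₀ hτ]
    linarith
  · refine ((hline (-s)).prodMk hzero).frequently (Eventually.frequently ?_)
    filter_upwards [hpos, (hline (-s)).eventually hmax] with τ hτ hle
    rw [le_div_iff₀ hτ]
    have hc : c + τ * -s + τ * s = c := by ring
    simp only [hc] at hle ⊢
    linarith

/-- The Lebourg mean value theorem on the real line. -/
theorem exists_slope_mem_clarkeSubdiff {F : ℝ → ℝ} (hF : LocallyLipschitz F) {x y : ℝ}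
    (hxy : x < y) : ∃ c ∈ Set.Ioo x y, (F y - F x) / (y - x) ∈ clarkeSubdiff F c := by
  have hne : y - x ≠ 0 := (sub_pos.2 hxy).ne'
  obtain ⟨c, hc, hext⟩ := exists_isLocalExtr_Ioo
    (f := fun z => F z - (F y - F x) / (y - x) * z) hxy
    (hF.continuous.sub (continuous_const.mul continuous_id)).continuousOn
    (by field_simp; ring)
  exact ⟨c, hc, mem_clarkeSubdiff_of_isLocalExtr hF hext⟩

theorem abs_sub_le_of_forall_mem_clarkeSubdiff {F : ℝ → ℝ} (hF : LocallyLipschitz F)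
    {x y K : ℝ} (hxy : x ≤ y) (h : ∀ c ∈ Set.Ioo x y, ∀ ξ ∈ clarkeSubdiff F c, |ξ| ≤ K) :
    |F y - F x| ≤ K * (y - x) := by
  rcases hxy.eq_or_lt with rfl | hlt
  · simp
  obtain ⟨c, hc, hm⟩ := exists_slope_mem_clarkeSubdiff hF hlt
  have := h c hc _ hm
  rwa [abs_div, abs_of_pos (sub_pos.2 hlt), div_le_iff₀ (sub_pos.2 hlt)] at this

/-- A bound on the Clarke subdifferential in a punctured neighbourhood extends to the centre. -/
theorem abs_le_of_punctured_bound {F : ℝ → ℝ} (hF : LocallyLipschitz F) {t δ K ξ : ℝ} (hδ : 0 < δ)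
    (h : ∀ c, 0 < |c - t| → |c - t| < δ → ∀ η ∈ clarkeSubdiff F c, |η| ≤ K)
    (hξ : ξ ∈ clarkeSubdiff F t) : |ξ| ≤ K := by
  have hmono : ∀ x ∈ Set.Ioo (t - δ) (t + δ), ∀ y ∈ Set.Ioo (t - δ) (t + δ), x ≤ y →
      |F y - F x| ≤ K * (y - x) := by
    intro x hx y hy hxy
    have hoff : ∀ a b, x ≤ a → b ≤ y → a ≤ b → t ∉ Set.Ioo a b →
        |F b - F a| ≤ K * (b - a) := by
      intro a b ha hb hab ht
      refine abs_sub_le_of_forall_mem_clarkeSubdiff hF hab fun c hc => h c ?_ ?_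
      · refine abs_pos.2 (sub_ne_zero.2 ?_)
        rintro rfl
        exact ht hc
      · exact abs_lt.2 ⟨by linarith [hx.1, hc.1], by linarith [hy.2, hc.2]⟩
    by_cases ht : t ∈ Set.Ioo x y
    · have h1 := hoff x t le_rfl ht.2.le ht.1.le fun h => lt_irrefl _ h.2
      have h2 := hoff t y ht.1.le le_rfl ht.2.le fun h => lt_irrefl _ h.1
      have h3 := abs_sub_le (F y) (F t) (F x)
      linarith
    · exact hoff x y le_rfl le_rfl hxy ht
  refine abs_le_of_mem_clarkeSubdiff (U := Set.Ioo (t - δ) (t + δ))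
    (Ioo_mem_nhds (by linarith) (by linarith))
    (fun x hx y hy => ?_) hξ
  rcases le_total x y with hxy | hxy
  · rw [abs_sub_comm, abs_sub_comm x, abs_of_nonneg (sub_nonneg.2 hxy)]
    exact hmono x hx y hy hxy
  · rw [abs_of_nonneg (sub_nonneg.2 hxy)]
    exact hmono y hy x hx hxy

theorem IsCompact.exists_bound_clarkeSubdiff {F : ℝ → ℝ} (hF : LocallyLipschitz F) {S : Set ℝ}
    (hS : IsCompact S) : ∃ K : ℝ, ∀ t ∈ S, ∀ ξ ∈ clarkeSubdiff F t, |ξ| ≤ K := by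
  refine hS.induction_on (p := fun S => ∃ K : ℝ, ∀ t ∈ S, ∀ ξ ∈ clarkeSubdiff F t, |ξ| ≤ K)
    ⟨0, by simp⟩ ?_ ?_ ?_
  · rintro s t hst ⟨K, hK⟩
    exact ⟨K, fun x hx => hK x (hst hx)⟩
  · rintro s t ⟨K, hK⟩ ⟨L, hL⟩
    refine ⟨max K L, fun x hx ξ hξ => ?_⟩
    rcases hx with hx | hx
    · exact (hK x hx ξ hξ).trans (le_max_left _ _)
    · exact (hL x hx ξ hξ).trans (le_max_right _ _)
  · intro x _
    obtain ⟨K, U, hU, hK⟩ := hF.exists_abs_sub_le x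
    refine ⟨interior U, mem_nhdsWithin_of_mem_nhds (interior_mem_nhds.2 hU), K, fun t ht ξ hξ => ?_⟩
    exact abs_le_of_mem_clarkeSubdiff (mem_interior_iff_mem_nhds.1 ht) hK hξ

theorem stmt_1 (F : ℝ → ℝ) (hF : LocallyLipschitz F)
    (H1 : ∀ ε > (0 : ℝ), ∃ δ > (0 : ℝ), ∀ t : ℝ, 0 < |t| → |t| < δ →
      ∀ ξ ∈ clarkeSubdiff F t, |ξ| ≤ ε * |t|)
    (H2 : ∀ ε > (0 : ℝ), ∃ T > (0 : ℝ), ∀ t : ℝ, T < |t| →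
      ∀ ξ ∈ clarkeSubdiff F t, |ξ| ≤ ε * |t|)
    (q : ℝ) (hq : 2 < q) :
    ∀ ε > (0 : ℝ), ∃ l > (0 : ℝ), ∀ t : ℝ, ∀ ξ ∈ clarkeSubdiff F t,
      |ξ| ≤ ε * |t| + l * |t| ^ (q - 1) := by
  intro ε hε
  obtain ⟨δ, hδ, hnear⟩ := H1 ε hε
  obtain ⟨T, hT, hfar⟩ := H2 ε hε
  obtain ⟨K, hK⟩ := (isCompact_Icc (a := -T) (b := T)).exists_bound_clarkeSubdiff hF
  have hδq : 0 < δ ^ (q - 1) := rpow_pos_of_pos hδ _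
  have hl : 0 < (|K| + 1) / δ ^ (q - 1) := by positivity
  refine ⟨_, hl, fun t ξ hξ => ?_⟩
  have hpow : 0 ≤ (|K| + 1) / δ ^ (q - 1) * |t| ^ (q - 1) := by positivity
  rcases (abs_nonneg t).eq_or_lt with h0 | h0
  · obtain rfl : t = 0 := abs_eq_zero.1 h0.symm
    have hξ0 : |ξ| ≤ 0 := by
      refine le_of_forall_pos_le_add fun η hη => ?_
      obtain ⟨ρ, hρ, hsmall⟩ := H1 η hη
      rw [zero_add]
      refine abs_le_of_punctured_bound hF (lt_min hρ one_pos) (fun c hc hcδ ζ hζ => ?_) hξ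
      rw [sub_zero] at hc hcδ
      have h1 : |c| ≤ 1 := (hcδ.trans_le (min_le_right _ _)).le
      exact (hsmall c hc (hcδ.trans_le (min_le_left _ _)) ζ hζ).trans
        (mul_le_of_le_one_right hη.le h1)
    have : 0 ≤ ε * |(0 : ℝ)| := by positivity
    linarith
  rcases lt_or_ge |t| δ with hlt | hge
  · linarith [hnear t h0 hlt ξ hξ]
  rcases lt_or_ge T |t| with hgt | hle
  · linarith [hfar t hgt ξ hξ]
  have hbase : |K| + 1 ≤ (|K| + 1) / δ ^ (q - 1) * |t| ^ (q - 1) := by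
    rw [div_mul_eq_mul_div, le_div_iff₀ hδq]
    gcongr
    linarith
  have hεt : 0 ≤ ε * |t| := by positivity
  linarith [hK t (abs_le.1 hle) ξ hξ, le_abs_self K]
end

section
/- (Super-quadraticity at infinity.) Let F : ℝ → ℝ be locally Lipschitz with F(0) = 0 and satisfying hypothesis (H)_1. Suppose there exist ν > 2 and C > 0 such that 2F(t) + F⁰(t;−t) ≤ −C|t|^ν for every t ∈ ℝ. Then F(t) ≥ (C/(ν−2))|t|^ν for every t ∈ ℝ. -/
open Filter Real

open scoped Topology

/-- The Clarke derivative of a locally Lipschitz function dominates its classical derivative. -/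
theorem HasDerivAt.mul_le_clarkeDeriv {F : ℝ → ℝ} (hF : LocallyLipschitz F) {x d : ℝ}
    (h : HasDerivAt F d x) (s : ℝ) : d * s ≤ clarkeDeriv F x s := by
  set q : ℝ × ℝ → ℝ := fun p => (F (p.1 + p.2 * s) - F p.1) / p.2 with hq
  have hbdd : ((𝓝 x) ×ˢ (𝓝[>] (0 : ℝ))).IsBoundedUnder (· ≤ ·) q := by
    obtain ⟨K, t, ht, hK⟩ := hF x
    refine ⟨K * |s|, eventually_map.2 ?_⟩
    have h1 : Tendsto (fun p : ℝ × ℝ => p.1) ((𝓝 x) ×ˢ (𝓝[>] (0 : ℝ))) (𝓝 x) := tendsto_fst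
    have h2 : Tendsto (fun p : ℝ × ℝ => p.2) ((𝓝 x) ×ˢ (𝓝[>] (0 : ℝ))) (𝓝[>] 0) := tendsto_snd
    have h3 : Tendsto (fun p : ℝ × ℝ => p.1 + p.2 * s) ((𝓝 x) ×ˢ (𝓝[>] (0 : ℝ))) (𝓝 x) := by
      simpa using h1.add ((tendsto_nhds_of_tendsto_nhdsWithin h2).mul_const s)
    filter_upwards [h1 ht, h3 ht, h2 self_mem_nhdsWithin] with p hp1 hp3 hp2
    have hp2 : 0 < p.2 := hp2
    have := hK.dist_le_mul _ hp3 _ hp1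
    rw [Real.dist_eq, Real.dist_eq, add_sub_cancel_left, abs_mul, abs_of_pos hp2] at this
    rw [hq]
    simp only
    rw [div_le_iff₀ hp2]
    calc _ ≤ _ := le_abs_self _
      _ ≤ _ := this
      _ = _ := by ring
  have hlim : Tendsto (fun τ : ℝ => q (x, τ)) (𝓝[>] 0) (𝓝 (d * s)) := by
    have hd : HasDerivAt (fun τ : ℝ => F (x + τ * s)) (d * s) 0 := by
      have h0 : HasDerivAt (fun τ : ℝ => x + τ * s) s 0 := by
        simpa using ((hasDerivAt_id (0 : ℝ)).mul_const s).const_add x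
      exact HasDerivAt.comp (h₂ := F) 0 (by simpa using h) h0
    have := hd.tendsto_slope_zero_right
    refine this.congr fun τ => ?_
    simp [hq, div_eq_inv_mul]
  have hv : Tendsto (fun τ : ℝ => (x, τ)) (𝓝[>] 0) ((𝓝 x) ×ˢ (𝓝[>] (0 : ℝ))) :=
    tendsto_const_nhds.prodMk tendsto_id
  refine le_of_forall_lt fun c hc => ?_
  obtain ⟨c', hcc', hc'⟩ := exists_between hc
  refine hcc'.trans_le (le_limsup_of_frequently_le ?_ hbdd)
  refine hv.frequently (p := fun p => c' ≤ q p) ?_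
  exact ((hlim.eventually (lt_mem_nhds hc')).mono fun _ h => h.le).frequently

theorem HasDerivAt.mem_clarkeSubdiff {F : ℝ → ℝ} (hF : LocallyLipschitz F) {x d : ℝ}
    (h : HasDerivAt F d x) : d ∈ clarkeSubdiff F x :=
  fun s => h.mul_le_clarkeDeriv hF s

/-- An absolutely continuous function whose derivative is nonnegative wherever it exists
is nondecreasing between the endpoints. -/
theorem AbsolutelyContinuousOnInterval.le_of_deriv_nonneg {f : ℝ → ℝ} {a b : ℝ} (hab : a ≤ b)
    (hf : AbsolutelyContinuousOnInterval f a b)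
    (h : ∀ x, a < x → x ≤ b → DifferentiableAt ℝ f x → 0 ≤ deriv f x) : f a ≤ f b := by
  rw [← sub_nonneg, ← hf.integral_deriv_eq_sub, intervalIntegral.integral_of_le hab]
  refine MeasureTheory.setIntegral_nonneg measurableSet_Ioc fun x hx => ?_
  by_cases hd : DifferentiableAt ℝ f x
  · exact h x hx.1 hx.2 hd
  · rw [deriv_zero_of_not_differentiableAt hd]

theorem LocallyLipschitz.absolutelyContinuousOnInterval {f : ℝ → ℝ} (hf : LocallyLipschitz f)
    (a b : ℝ) : AbsolutelyContinuousOnInterval f a b := by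
  obtain ⟨K, hK⟩ := (hf.locallyLipschitzOn (s := Set.uIcc a b)).exists_lipschitzOnWith_of_compact
    isCompact_uIcc
  exact hK.absolutelyContinuousOnInterval

theorem stmt_7 (F : ℝ → ℝ) (hF : LocallyLipschitz F) (hF0 : F 0 = 0)
    (H1 : ∀ ε > (0 : ℝ), ∃ δ > (0 : ℝ), ∀ t : ℝ, 0 < |t| → |t| < δ →
      ∀ ξ ∈ clarkeSubdiff F t, |ξ| ≤ ε * |t|)
    (ν C : ℝ) (hν : 2 < ν) (hC : 0 < C)
    (H4 : ∀ t : ℝ, 2 * F t + clarkeDeriv F t (-t) ≤ -C * |t| ^ ν) :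
    ∀ t : ℝ, F t ≥ C / (ν - 2) * |t| ^ ν := by
  intro t
  have hν2 : 0 < ν - 2 := sub_pos.2 hν
  rcases eq_or_ne t 0 with rfl | ht
  · rw [hF0, abs_zero, Real.zero_rpow (by linarith), mul_zero]
  have ht' : 0 < |t| := abs_pos.2 ht
  set K : ℝ → ℝ := fun u => F (u * t) with hK
  have hKL : LocallyLipschitz K :=
    hF.comp (ContDiff.locallyLipschitz (𝕂 := ℝ) (f := fun u : ℝ => u * t) (by fun_prop))
  have hderiv : ∀ u d : ℝ, HasDerivAt K d u → HasDerivAt F (d / t) (u * t) := by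
    intro u d h
    have h0 : HasDerivAt (fun y : ℝ => y / t) (1 / t) (u * t) := (hasDerivAt_id _).div_const t
    have h1 := HasDerivAt.comp (h₂ := K) (u * t) (by simpa [ht] using h) h0
    refine (h1.congr_deriv (by ring)).congr_of_eventuallyEq (Eventually.of_forall fun y => ?_)
    simp [hK, ht]
  have hgrowth : ∀ u d : ℝ, 0 < u → HasDerivAt K d u →
      2 * K u - u * d ≤ -C * (|t| ^ ν * u ^ ν) := by
    intro u d hu h
    have h1 := (hderiv u d h).mul_le_clarkeDeriv hF (-(u * t))
    have h2 := H4 (u * t)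
    rw [abs_mul, abs_of_pos hu, Real.mul_rpow hu.le ht'.le] at h2
    have h3 : d / t * -(u * t) = -(u * d) := by field_simp
    simp only [hK]
    linarith
  have hlower : ∀ ε > (0 : ℝ), ∀ᶠ u in 𝓝[>] (0 : ℝ), -(ε * u ^ 2) ≤ K u := by
    intro ε hε
    obtain ⟨δ, hδ, H⟩ := H1 (2 * ε / t ^ 2) (by positivity)
    have hmem : Set.Ioo (0 : ℝ) (δ / |t|) ∈ 𝓝[>] (0 : ℝ) := Ioo_mem_nhdsGT (by positivity)
    filter_upwards [hmem] with b hb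
    have hq : LocallyLipschitz (fun u : ℝ => ε * u ^ 2) :=
      ContDiff.locallyLipschitz (𝕂 := ℝ) (by fun_prop)
    have hac := (hKL.absolutelyContinuousOnInterval 0 b).add
      (hq.absolutelyContinuousOnInterval 0 b)
    have := hac.le_of_deriv_nonneg hb.1.le fun u hu hub hd => ?_
    · simp [hK, hF0] at this
      linarith
    have hqd : HasDerivAt (fun u : ℝ => ε * u ^ 2) (ε * (2 * u)) u := by
      simpa using (hasDerivAt_pow 2 u).const_mul ε
    have hKd := hd.hasDerivAt.sub hqd
    rw [add_sub_cancel_right] at hKd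
    have hut : |u * t| = u * |t| := by rw [abs_mul, abs_of_pos hu]
    have h1 := H (u * t) (by rw [hut]; positivity)
      (by rw [hut]; exact (lt_div_iff₀ ht').1 (hub.trans_lt hb.2)) _
      ((hderiv u _ hKd).mem_clarkeSubdiff hF)
    rw [hut, abs_div, div_le_iff₀ ht'] at h1
    have h2 : 2 * ε / t ^ 2 * (u * |t|) * |t| = 2 * ε * u := by
      rw [← sq_abs t]; field_simp
    rw [h2] at h1
    linarith [neg_abs_le (deriv (K + fun u => ε * u ^ 2) u - ε * (2 * u))]
  set D : ℝ := C / (ν - 2) * |t| ^ ν with hD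
  have hmono : ∀ δ : ℝ, 0 < δ → δ ≤ 1 → K δ * (δ ^ 2)⁻¹ - D * δ ^ (ν - 2) ≤ K 1 - D := by
    intro δ hδ hδ1
    have hpos : ∀ u ∈ Set.uIcc δ 1, u ≠ 0 := by
      intro u hu
      rw [Set.uIcc_of_le hδ1] at hu
      exact (hδ.trans_le hu.1).ne'
    have hI : AbsolutelyContinuousOnInterval (fun u : ℝ => (u ^ 2)⁻¹) δ 1 :=
      ContDiffOn.absolutelyContinuousOnInterval
        ((contDiffOn_id.pow 2).inv fun u hu => pow_ne_zero 2 (hpos u hu))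
    have hP : AbsolutelyContinuousOnInterval (fun u : ℝ => D * u ^ (ν - 2)) δ 1 :=
      ContDiffOn.absolutelyContinuousOnInterval
        (contDiffOn_const.mul (contDiffOn_id.rpow_const_of_ne hpos))
    have hac := ((hKL.absolutelyContinuousOnInterval δ 1).mul hI).sub hP
    have := hac.le_of_deriv_nonneg hδ1 fun u hu _ hd => ?_
    · simpa using this
    have hu : 0 < u := hδ.trans hu
    have hPd : HasDerivAt (fun u : ℝ => D * u ^ (ν - 2)) (D * ((ν - 2) * u ^ (ν - 2 - 1))) u :=
      (Real.hasDerivAt_rpow_const (Or.inl hu.ne')).const_mul D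
    have hId : DifferentiableAt ℝ (fun u : ℝ => (u ^ 2)⁻¹) u :=
      (differentiableAt_pow 2).inv (by positivity)
    have hKdiff : DifferentiableAt ℝ K u := by
      have h1 := (hd.add hPd.differentiableAt).mul (differentiableAt_pow (𝕜 := ℝ) (x := u) 2)
      refine h1.congr_of_eventuallyEq ?_
      filter_upwards [lt_mem_nhds hu] with y hy
      simp [hy.ne']
    have hId' : HasDerivAt (fun u : ℝ => (u ^ 2)⁻¹) (-(2 * u) / (u ^ 2) ^ 2) u := by
      simpa using (hasDerivAt_pow 2 u).fun_inv (by positivity)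
    rw [((hKdiff.hasDerivAt.mul hId').sub hPd).deriv]
    have hg := hgrowth u _ hu hKdiff.hasDerivAt
    have hpow : u ^ ν = u ^ (ν - 2 - 1) * u ^ 3 := by
      rw [← Real.rpow_natCast, ← Real.rpow_add hu]; congr 1; push_cast; ring
    have hDC : D * (ν - 2) = C * |t| ^ ν := by rw [hD]; field_simp
    have key : (deriv K u * (u ^ 2)⁻¹ + K u * (-(2 * u) / (u ^ 2) ^ 2) -
        D * ((ν - 2) * u ^ (ν - 2 - 1))) * u ^ 3 =
        u * deriv K u - 2 * K u - C * (|t| ^ ν * u ^ ν) := by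
      rw [← mul_assoc D, hDC, hpow]
      field_simp
      ring
    refine nonneg_of_mul_nonneg_left (b := u ^ 3) ?_ (by positivity)
    rw [key]
    linarith
  have hK1 : K 1 = F t := by simp [hK]
  rw [ge_iff_le, ← sub_nonneg, ← hK1]
  refine le_of_forall_pos_le_add fun ε hε => ?_
  have hlim : Tendsto (fun δ : ℝ => -ε - D * δ ^ (ν - 2)) (𝓝[>] 0) (𝓝 (-ε)) := by
    have h0 : Tendsto (fun δ : ℝ => δ ^ (ν - 2)) (𝓝[>] 0) (𝓝 0) := by
      have := (Real.continuousAt_rpow_const 0 (ν - 2) (Or.inr hν2.le)).tendsto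
      rw [Real.zero_rpow hν2.ne'] at this
      exact this.mono_left nhdsWithin_le_nhds
    simpa using (h0.const_mul D).const_sub (-ε)
  have hle : -ε ≤ K 1 - D := by
    refine le_of_tendsto hlim ?_
    have hmem : Set.Ioo (0 : ℝ) 1 ∈ 𝓝[>] (0 : ℝ) := Ioo_mem_nhdsGT one_pos
    filter_upwards [hlower ε hε, hmem] with δ h hδ
    have hδ0 : 0 < δ := hδ.1
    refine le_trans ?_ (hmono δ hδ0 hδ.2.le)
    have : -ε ≤ K δ * (δ ^ 2)⁻¹ := by
      rw [← div_eq_mul_inv, le_div_iff₀ (by positivity)]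
      linarith
    linarith
  linarith
end

section
/- Let (X, d) be a metric space equipped with a Borel measure μ, let x₀ ∈ X, let 0 ≤ r < R, and set A = A_{x₀}(r,R) = {x ∈ X : r < d(x₀,x) < R}. Assume 0 < μ(A) < ∞. Let α : X → ℝ be measurable with 0 ≤ α ≤ ‖α‖_∞ μ-a.e. for some ‖α‖_∞ < ∞, and suppose α(x) ≥ α₀ for μ-a.e. x ∈ A, where α₀ > 0. Let F : ℝ → ℝ be continuous with F(0) = 0, and suppose F(t₀) > 0 for some t₀ > 0. Then there exists a Lipschitz function w : X → ℝ with 0 ≤ w ≤ t₀, w = 0 outside A, such that x ↦ α(x)F(w(x)) is μ-integrable and ∫_X α F(w) dμ > 0. -/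
open MeasureTheory

open Filter Topology

/-- The radial plateau function with height `t` and slope `c` on the annulus `r < d(x₀, x) < R`. -/
noncomputable def annulusPlateau {X : Type*} [MetricSpace X] (x₀ : X) (r R t c : ℝ) (x : X) : ℝ :=
  max 0 (min t (min (c * (dist x₀ x - r)) (c * (R - dist x₀ x))))

namespace annulusPlateau

variable {X : Type*} [MetricSpace X] (x₀ : X) {r R t c : ℝ}

theorem lipschitzWith (hc : 0 ≤ c) :
    LipschitzWith c.toNNReal (annulusPlateau x₀ r R t c) := by
  have h₁ : LipschitzWith c.toNNReal fun x => c * (dist x₀ x - r) := by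
    refine LipschitzWith.of_dist_le_mul fun x y => ?_
    rw [Real.dist_eq, Real.coe_toNNReal c hc, ← mul_sub, abs_mul, abs_of_nonneg hc,
      sub_sub_sub_cancel_right, dist_comm x₀ x, dist_comm x₀ y]
    exact mul_le_mul_of_nonneg_left (abs_dist_sub_le x y x₀) hc
  have h₂ : LipschitzWith c.toNNReal fun x => c * (R - dist x₀ x) := by
    refine LipschitzWith.of_dist_le_mul fun x y => ?_
    rw [Real.dist_eq, Real.coe_toNNReal c hc, ← mul_sub, abs_mul, abs_of_nonneg hc,
      sub_sub_sub_cancel_left, abs_sub_comm, dist_comm x₀ x, dist_comm x₀ y]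
    exact mul_le_mul_of_nonneg_left (abs_dist_sub_le x y x₀) hc
  have h := ((h₁.min h₂).const_min t).const_max 0
  rw [max_self] at h
  exact h

theorem nonneg (x : X) : 0 ≤ annulusPlateau x₀ r R t c x := le_max_left _ _

theorem le_height (ht : 0 ≤ t) (x : X) : annulusPlateau x₀ r R t c x ≤ t :=
  max_le ht (min_le_left _ _)

theorem eq_zero (hc : 0 ≤ c) {x : X} (hx : ¬(r < dist x₀ x ∧ dist x₀ x < R)) :
    annulusPlateau x₀ r R t c x = 0 := by
  refine max_eq_left ?_
  by_cases h : r < dist x₀ x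
  · have h' : R ≤ dist x₀ x := not_lt.1 fun h' => hx ⟨h, h'⟩
    exact (min_le_right _ _).trans ((min_le_right _ _).trans
      (mul_nonpos_of_nonneg_of_nonpos hc (sub_nonpos.2 h')))
  · exact (min_le_right _ _).trans ((min_le_left _ _).trans
      (mul_nonpos_of_nonneg_of_nonpos hc (sub_nonpos.2 (not_lt.1 h))))

theorem eventually_eq_height (ht : 0 ≤ t) {x : X} (hx : r < dist x₀ x ∧ dist x₀ x < R) :
    ∀ᶠ n : ℕ in atTop, annulusPlateau x₀ r R t n x = t := by
  have h₁ : Tendsto (fun n : ℕ => (n : ℝ) * (dist x₀ x - r)) atTop atTop :=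
    tendsto_natCast_atTop_atTop.atTop_mul_const (sub_pos.2 hx.1)
  have h₂ : Tendsto (fun n : ℕ => (n : ℝ) * (R - dist x₀ x)) atTop atTop :=
    tendsto_natCast_atTop_atTop.atTop_mul_const (sub_pos.2 hx.2)
  filter_upwards [h₁.eventually_ge_atTop t, h₂.eventually_ge_atTop t] with n hn₁ hn₂
  rw [annulusPlateau, min_eq_left (le_min hn₁ hn₂), max_eq_right ht]

end annulusPlateau

theorem stmt_12 {X : Type*} [MetricSpace X] [MeasurableSpace X] [BorelSpace X]
    (μ : Measure X) (x₀ : X) (r R : ℝ) (hr : 0 ≤ r) (hrR : r < R)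
    (hApos : 0 < μ {x : X | r < dist x₀ x ∧ dist x₀ x < R})
    (hAfin : μ {x : X | r < dist x₀ x ∧ dist x₀ x < R} < ⊤)
    (α : X → ℝ) (hα : Measurable α)
    (A : ℝ) (hbd : ∀ᵐ x ∂μ, 0 ≤ α x ∧ α x ≤ A)
    (α₀ : ℝ) (hα₀ : 0 < α₀)
    (hlow : ∀ᵐ x ∂μ, (r < dist x₀ x ∧ dist x₀ x < R) → α₀ ≤ α x)
    (F : ℝ → ℝ) (hF : Continuous F) (hF0 : F 0 = 0)
    (t₀ : ℝ) (ht₀ : 0 < t₀) (hFt₀ : 0 < F t₀) :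
    ∃ w : X → ℝ, (∃ K : NNReal, LipschitzWith K w) ∧
      (∀ x, 0 ≤ w x ∧ w x ≤ t₀) ∧
      (∀ x : X, ¬(r < dist x₀ x ∧ dist x₀ x < R) → w x = 0) ∧
      Integrable (fun x => α x * F (w x)) μ ∧
      0 < ∫ x, α x * F (w x) ∂μ := by
  set S : Set X := {x | r < dist x₀ x ∧ dist x₀ x < R}
  have hSm : MeasurableSet S :=
    ((isOpen_lt continuous_const (continuous_const.dist continuous_id)).inter
      (isOpen_lt (continuous_const.dist continuous_id) continuous_const)).measurableSet
  obtain ⟨M, hM⟩ := isCompact_Icc.exists_bound_of_continuousOn (s := Set.Icc 0 t₀) hF.continuousOn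
  let w : ℕ → X → ℝ := fun n => annulusPlateau x₀ r R t₀ n
  have hwL (n : ℕ) : LipschitzWith (n : ℝ).toNNReal (w n) :=
    annulusPlateau.lipschitzWith x₀ n.cast_nonneg
  have hw0 (n : ℕ) (x : X) (hx : x ∉ S) : w n x = 0 :=
    annulusPlateau.eq_zero x₀ n.cast_nonneg hx
  have hw (n : ℕ) (x : X) : 0 ≤ w n x ∧ w n x ≤ t₀ :=
    ⟨annulusPlateau.nonneg x₀ x, annulusPlateau.le_height x₀ ht₀.le x⟩
  have hmeas (n : ℕ) : AEStronglyMeasurable (fun x => α x * F (w n x)) μ :=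
    (hα.mul (hF.measurable.comp (hwL n).continuous.measurable)).aestronglyMeasurable
  have hindicator (c : ℝ) : Integrable (S.indicator fun _ => c) μ :=
    (integrable_indicator_iff hSm).2 (integrableOn_const hAfin.ne)
  have hbound (n : ℕ) : ∀ᵐ x ∂μ, ‖α x * F (w n x)‖ ≤ S.indicator (fun _ => A * M) x := by
    filter_upwards [hbd] with x hx
    by_cases hxS : x ∈ S
    · rw [Set.indicator_of_mem hxS, norm_mul, Real.norm_of_nonneg hx.1]
      exact mul_le_mul hx.2 (hM _ (hw n x)) (norm_nonneg _) (hx.1.trans hx.2)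
    · simp [hw0 n x hxS, hF0, hxS]
  have hlim : ∀ᵐ x ∂μ, Tendsto (fun n => α x * F (w n x)) atTop
      (𝓝 (S.indicator (fun x => α x * F t₀) x)) := by
    refine .of_forall fun x => ?_
    by_cases hxS : x ∈ S
    · refine tendsto_const_nhds.congr' ?_
      filter_upwards [annulusPlateau.eventually_eq_height x₀ ht₀.le hxS] with n hn
      simp only [w, hn, Set.indicator_of_mem hxS]
    · simp [hw0 _ x hxS, hF0, hxS]
  have htendsto := tendsto_integral_of_dominated_convergence _ hmeas (hindicator _) hbound hlim
  have hlimint : Integrable (S.indicator fun x => α x * F t₀) μ := by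
    refine (hindicator (A * F t₀)).mono'
      ((hα.mul_const _).indicator hSm).aestronglyMeasurable ?_
    filter_upwards [hbd] with x hx
    by_cases hxS : x ∈ S
    · rw [Set.indicator_of_mem hxS, Set.indicator_of_mem hxS, norm_mul,
        Real.norm_of_nonneg hx.1, Real.norm_of_nonneg hFt₀.le]
      exact mul_le_mul_of_nonneg_right hx.2 hFt₀.le
    · simp [hxS]
  have hpos : 0 < ∫ x, S.indicator (fun x => α x * F t₀) x ∂μ := by
    calc 0 < μ.real S * (α₀ * F t₀) :=
          mul_pos (ENNReal.toReal_pos hApos.ne' hAfin.ne) (mul_pos hα₀ hFt₀)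
      _ = ∫ x, S.indicator (fun _ => α₀ * F t₀) x ∂μ := by
          rw [integral_indicator_const _ hSm, smul_eq_mul]
      _ ≤ _ := by
          refine integral_mono_ae (hindicator _) hlimint ?_
          filter_upwards [hlow] with x hx
          by_cases hxS : x ∈ S
          · simpa only [Set.indicator_of_mem hxS] using
              mul_le_mul_of_nonneg_right (hx hxS) hFt₀.le
          · simp [hxS]
  obtain ⟨n, hn⟩ := (htendsto.eventually_const_lt hpos).exists
  exact ⟨w n, ⟨_, hwL n⟩, hw n, hw0 n, (hindicator _).mono' (hmeas n) (hbound n), hn⟩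
end
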